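/- arXiv:2511.01637 — 2 statements merged into one kernel-verified Lean document; each statement's English description precedes it below -/
import Mathlib

section
/- Let m ≥ 1, let f : ℂ^m → ℂ be a nonconstant entire function, let u ∈ ℂ^m be a unit vector, and let n ≥ 2 be an integer such that ∂_u(f^n) is not identically zero. If f^n and ∂_u(f^n) share the value 1 IM, then f = n·∂_u f identically on ℂ^m. (Paper's Theorem 2.3.) -/
/-- The directional derivative of `f : ℂ^m → ℂ` along the direction `u`. -/
noncomputable def dirDeriv {m : ℕ} (u : Fin m → ℂ) (f : (Fin m → ℂ) → ℂ) :
    (Fin m → ℂ) → ℂ :=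
  fun z => fderiv ℂ f z u

section EntireSharing

open Set Filter Topology Metric

theorem exists_exp_eq_of_isExactOn {U : Set ℂ} (hU : IsOpen U) (hUc : IsPreconnected U)
    {f : ℂ → ℂ} (hf : DifferentiableOn ℂ f U) (h0 : ∀ z ∈ U, f z ≠ 0)
    (hex : Complex.IsExactOn (fun z => deriv f z / f z) U) :
    ∃ p : ℂ → ℂ, DifferentiableOn ℂ p U ∧ ∀ z ∈ U, f z = Complex.exp (p z) := by
  rcases U.eq_empty_or_nonempty with rfl | ⟨c, hc⟩
  · exact ⟨0, by simp, by simp⟩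
  obtain ⟨q, hq⟩ := hex
  have hd : ∀ z ∈ U, HasDerivAt (fun z => f z * Complex.exp (-q z)) 0 z := by
    intro z hz
    have h1 := ((hf z hz).differentiableAt (hU.mem_nhds hz)).hasDerivAt
    convert! h1.mul (hq z hz).neg.cexp using 1
    field_simp [h0 z hz]
    ring
  have hconst : ∀ z ∈ U, f z * Complex.exp (-q z) = f c * Complex.exp (-q c) := by
    intro z hz
    exact hU.is_const_of_deriv_eq_zero hUc
      (fun w hw => (hd w hw).differentiableAt.differentiableWithinAt)
      (fun w hw => (hd w hw).deriv) hz hc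
  refine ⟨fun z => q z + (Complex.log (f c) - q c), fun z hz =>
    ((hq z hz).differentiableAt.add_const _).differentiableWithinAt, fun z hz => ?_⟩
  have := hconst z hz
  rw [Complex.exp_add, Complex.exp_sub, Complex.exp_log (h0 c hc)]
  rw [Complex.exp_neg, Complex.exp_neg] at this
  field_simp [Complex.exp_ne_zero] at this ⊢
  linear_combination this

theorem exists_entire_mul_eq {A B : ℂ → ℂ} (hA : Differentiable ℂ A) (hB : Differentiable ℂ B)
    (h : ∀ z, B z = 0 → A z = 0 ∧ deriv B z ≠ 0) :
    ∃ K : ℂ → ℂ, Differentiable ℂ K ∧ ∀ z, A z = K z * B z := by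
  classical
  refine ⟨fun z => if B z = 0 then deriv A z / deriv B z else A z / B z, ?_, ?_⟩
  · intro z
    have hdA : DifferentiableAt ℂ (dslope A z) z :=
      ((Complex.differentiableOn_dslope univ_mem).2 hA.differentiableOn).differentiableAt univ_mem
    have hdB : DifferentiableAt ℂ (dslope B z) z :=
      ((Complex.differentiableOn_dslope univ_mem).2 hB.differentiableOn).differentiableAt univ_mem
    by_cases hz : B z = 0
    · obtain ⟨hAz, hB'⟩ := h z hz
      have hne : dslope B z z ≠ 0 := by rwa [dslope_same]
      refine (hdA.div hdB hne).congr_of_eventuallyEq ?_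
      filter_upwards [hdB.continuousAt.eventually_ne hne] with w hw
      by_cases hwz : w = z
      · subst hwz; simp [hz, dslope_same]
      · have hBw : B w = (w - z) * dslope B z w := by
          have := sub_smul_dslope B z w
          rw [hz, sub_zero] at this
          simpa using this.symm
        have hAw : A w = (w - z) * dslope A z w := by
          have := sub_smul_dslope A z w
          rw [hAz, sub_zero] at this
          simpa using this.symm
        have hs : w - z ≠ 0 := sub_ne_zero.2 hwz
        have : B w ≠ 0 := by rw [hBw]; exact mul_ne_zero hs hw
        simp only [this, if_false, Pi.div_apply]
        rw [hAw, hBw]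
        field_simp
    · refine ((hA z).div (hB z) hz).congr_of_eventuallyEq ?_
      filter_upwards [(hB z).continuousAt.eventually_ne hz] with w hw
      simp [hw]
  · intro z
    by_cases hz : B z = 0
    · simp [hz, (h z hz).1]
    · simp [hz]

theorem norm_le_gronwallBound_of_norm_deriv_le {f : ℂ → ℂ} (hf : Differentiable ℂ f)
    {c z : ℂ} {K ε : ℝ}
    (h : ∀ w, dist w c ≤ dist z c → ‖deriv f w‖ ≤ K * ‖f w‖ + ε) :
    ‖f z‖ ≤ gronwallBound ‖f c‖ (K * dist z c) (ε * dist z c) 1 := by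
  set γ : ℝ → ℂ := fun s => f (c + s * (z - c)) with hγ
  have hd : ∀ s : ℝ, HasDerivAt γ (deriv f (c + s * (z - c)) * (z - c)) s := by
    intro s
    have h1 : HasDerivAt (fun s : ℂ => c + s * (z - c)) (z - c) s := by
      simpa using ((hasDerivAt_id (s : ℂ)).mul_const (z - c)).const_add c
    have h2 := (hf (c + s * (z - c))).hasDerivAt.comp (s : ℂ) h1
    exact h2.comp_ofReal
  have := norm_le_gronwallBound_of_norm_deriv_right_le (f := γ) (a := 0) (b := 1)
    (δ := ‖f c‖) (K := K * dist z c) (ε := ε * dist z c)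
    (fun s _ => (hd s).continuousAt.continuousWithinAt)
    (fun s _ => (hd s).hasDerivWithinAt) (by simp [hγ]) (fun s hs => ?_) 1 (by simp)
  · simpa [hγ] using this
  · rw [norm_mul, ← dist_eq_norm]
    have hw : dist (c + s * (z - c)) c ≤ dist z c := by
      rw [dist_eq_norm, dist_eq_norm, add_sub_cancel_left, norm_mul, Complex.norm_real,
        Real.norm_of_nonneg hs.1]
      nlinarith [norm_nonneg (z - c), hs.2]
    calc _ ≤ (K * ‖f (c + s * (z - c))‖ + ε) * dist z c := by gcongr; exact h _ hw
      _ = _ := by ring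

theorem norm_le_exp_of_norm_deriv_le {f : ℂ → ℂ} (hf : Differentiable ℂ f) {c z : ℂ} {C : ℝ}
    (hC : 0 < C) (h : ∀ w, dist w c ≤ dist z c → ‖deriv f w‖ ≤ C * (1 + ‖f w‖)) :
    ‖f z‖ ≤ (‖f c‖ + 1) * Real.exp (C * dist z c) := by
  have := norm_le_gronwallBound_of_norm_deriv_le hf (K := C) (ε := C)
    (fun w hw => (h w hw).trans_eq (by ring))
  rcases (dist_nonneg (x := z) (y := c)).eq_or_lt with h0 | h0
  · rw [eq_comm, dist_eq_zero] at h0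
    subst h0; simp
  · rw [gronwallBound_of_K_ne_0 (by positivity), div_self (by positivity)] at this
    simp only [mul_one, one_mul] at this
    linarith

theorem eq_zero_of_norm_deriv_le {f : ℂ → ℂ} (hf : Differentiable ℂ f) {c z : ℂ} {C : ℝ}
    (hc : f c = 0) (h : ∀ w, dist w c ≤ dist z c → ‖deriv f w‖ ≤ C * ‖f w‖) : f z = 0 := by
  have := norm_le_gronwallBound_of_norm_deriv_le hf (K := C) (ε := 0)
    (fun w hw => (h w hw).trans_eq (by ring))
  rw [hc, norm_zero, zero_mul, gronwallBound_ε0_δ0] at this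
  exact norm_le_zero_iff.1 this

theorem exists_almost_maximal {E : Set ℂ} (hE : IsClosed E) {q : ℂ → ℝ} (hq : Continuous q)
    {N : ℝ} (hN : 0 < N) {x : ℂ} (hx : x ∈ E) (hxN : 2 * N < q x) :
    ∃ z ∈ E, N < q z ∧ ∀ w ∈ E, dist w z * q z ≤ N → q w ≤ 2 * q z := by
  have hcpt : IsCompact (E ∩ closedBall x 1) := (isCompact_closedBall x 1).inter_left hE
  obtain ⟨z, ⟨hzE, hz1⟩, hmax⟩ := hcpt.exists_isMaxOn ⟨x, hx, by simp⟩
    (f := fun z => (1 - dist z x) * q z) (by fun_prop)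
  have hV : q x ≤ (1 - dist z x) * q z := by simpa using hmax (show x ∈ E ∩ closedBall x 1 by simp [hx])
  rw [mem_closedBall] at hz1
  have hd := dist_nonneg (x := z) (y := x)
  have hqz : 0 < q z := by
    by_contra hcon
    nlinarith
  refine ⟨z, hzE, by nlinarith, fun w hw hwz => ?_⟩
  have hlt : dist w z < (1 - dist z x) / 2 := by
    by_contra hcon
    push Not at hcon
    nlinarith
  have htri := dist_triangle w z x
  have hw1 : (1 - dist w x) * q w ≤ (1 - dist z x) * q z :=
    hmax (show w ∈ E ∩ closedBall x 1 from ⟨hw, by rw [mem_closedBall]; linarith⟩)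
  by_contra hcon
  push Not at hcon
  nlinarith

theorem exists_eq_exp_linear {A : ℂ → ℂ} (hA : Differentiable ℂ A) (h0 : ∀ z, A z ≠ 0)
    {B C : ℝ} (hB : 0 < B) (hC : 0 < C) (h : ∀ z, ‖A z‖ ≤ B * Real.exp (C * ‖z‖)) :
    ∃ a b : ℂ, ∀ z, A z = Complex.exp (a * z + b) := by
  have hlog : Differentiable ℂ (fun z => deriv A z / A z) :=
    fun z => (hA.deriv z).div (hA z) (h0 z)
  obtain ⟨p, hp, hAp⟩ := exists_exp_eq_of_isExactOn isOpen_univ isPreconnected_univ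
    hA.differentiableOn (fun z _ => h0 z) hlog.isExactOn_univ
  rw [differentiableOn_univ] at hp
  replace hAp : ∀ z, A z = Complex.exp (p z) := fun z => hAp z trivial
  have hre : ∀ z, (p z).re ≤ |Real.log B| + C * ‖z‖ := by
    intro z
    have h1 := h z
    rw [hAp, Complex.norm_exp] at h1
    have h2 := Real.log_le_log (Real.exp_pos _) h1
    rw [Real.log_exp, Real.log_mul hB.ne' (Real.exp_pos _).ne', Real.log_exp] at h2
    linarith [le_abs_self (Real.log B)]
  have hlin : ∀ z, ‖p z‖ ≤ 2 * (|Real.log B| + 2 * C * (‖z‖ + 1)) + 3 * ‖p 0‖ := by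
    intro z
    have hz := norm_nonneg z
    have hM : 0 < |Real.log B| + 2 * C * (‖z‖ + 1) := by positivity
    have := Complex.borelCaratheodory (f := p) (z := z) (R := 2 * (‖z‖ + 1)) hM
      hp.differentiableOn (fun w hw => ?_) (by positivity) (by simp; linarith)
    · refine this.trans ?_
      have hden : 0 < 2 * (‖z‖ + 1) - ‖z‖ := by linarith
      gcongr
      · rw [div_le_iff₀ hden]; gcongr; linarith
      · rw [div_le_iff₀ hden]
        have := norm_nonneg (p 0)
        nlinarith
    · have hw' : ‖w‖ < 2 * (‖z‖ + 1) := by simpa using hw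
      have := hre w
      simp only [mem_ofPred_eq]
      nlinarith
  obtain ⟨D, hD0, hD⟩ : ∃ D > 0, ∀ z, ‖p z‖ ≤ D * (‖z‖ + 1) := by
    refine ⟨2 * |Real.log B| + 4 * C + 3 * ‖p 0‖, by positivity, fun z => (hlin z).trans ?_⟩
    have := norm_nonneg z
    have h1 := abs_nonneg (Real.log B)
    have h2 := norm_nonneg (p 0)
    nlinarith [mul_nonneg this h1, mul_nonneg this h2]
  have hbd : ∀ z, ‖deriv p z‖ ≤ 2 * D := by
    intro z
    have hR : 0 < ‖z‖ + 1 := by positivity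
    have := Complex.norm_deriv_le_of_forall_mem_sphere_norm_le (f := p) (c := z)
      (C := D * (2 * (‖z‖ + 1))) hR hp.diffContOnCl (fun w hw => (hD w).trans ?_)
    · refine this.trans_eq ?_
      field_simp
    · gcongr
      have hw' : dist w z = ‖z‖ + 1 := hw
      have := norm_le_norm_add_norm_sub' w z
      rw [← dist_eq_norm, hw'] at this
      linarith
  obtain ⟨a, ha⟩ := hp.deriv.exists_const_forall_eq_of_bounded
    (isBounded_iff_forall_norm_le.2 ⟨2 * D, by rintro _ ⟨z, rfl⟩; exact hbd z⟩)
  refine ⟨a, p 0, fun z => ?_⟩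
  have hd : ∀ w, HasDerivAt (fun z => p z - a * z) 0 w := by
    intro w
    have := (hp w).hasDerivAt.sub ((hasDerivAt_id w).const_mul a)
    rw [ha w, mul_one, sub_self] at this
    exact this
  have := is_const_of_deriv_eq_zero (fun w => (hd w).differentiableAt) (fun w => (hd w).deriv) z 0
  rw [hAp]
  congr 1
  simp at this
  linear_combination this

theorem norm_deriv_zero_le_of_unit_disc {H : ℂ → ℂ} (hd : DifferentiableOn ℂ H (ball 0 1))
    (h0 : ∀ z ∈ ball (0 : ℂ) 1, H z ≠ 0) (h1 : ∀ z ∈ ball (0 : ℂ) 1, ‖H z‖ < 1)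
    {D : ℂ} (hD : HasDerivAt H D 1) (hH1 : ‖H 1‖ = 1) :
    ‖deriv H 0‖ ≤ 4 * ‖D‖ * ‖H 0‖ := by
  have hmem0 : (0 : ℂ) ∈ ball (0 : ℂ) 1 := by simp
  have hlog : DifferentiableOn ℂ (fun z => deriv H z / H z) (ball 0 1) :=
    (hd.deriv isOpen_ball).div hd h0
  obtain ⟨p, hp, hHp⟩ := exists_exp_eq_of_isExactOn isOpen_ball
    (convex_ball (0 : ℂ) 1).isPreconnected hd h0 hlog.isExactOn_ball
  have hre : ∀ z ∈ ball (0 : ℂ) 1, (p z).re < 0 := by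
    intro z hz
    have := h1 z hz
    rw [hHp z hz, Complex.norm_exp] at this
    simpa using this
  set a := -(p 0).re with ha
  have ha0 : 0 < a := by have := hre 0 hmem0; linarith
  set den : ℂ → ℂ := fun z => p z + starRingEnd ℂ (p 0) with hden
  have hden0 : ∀ z ∈ ball (0 : ℂ) 1, den z ≠ 0 := by
    intro z hz h
    have := congrArg Complex.re h
    simp [hden] at this
    linarith [hre z hz]
  set S : ℂ → ℂ := fun z => (p z - p 0) / den z with hS
  have hSd : DifferentiableOn ℂ S (ball 0 1) := (hp.sub_const _).div (hp.add_const _) hden0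
  have hsq : ∀ z, Complex.normSq (den z) - Complex.normSq (p z - p 0)
      = 4 * (p z).re * (p 0).re := by
    intro z
    simp [hden, Complex.normSq_apply]; ring
  have hS1 : MapsTo S (ball 0 1) (ball 0 1) := by
    intro z hz
    have hz' := hsq z
    have hpos : 0 < 4 * (p z).re * (p 0).re := by nlinarith [hre z hz, hre 0 hmem0]
    rw [mem_ball_zero_iff, hS]
    simp only [norm_div]
    rw [div_lt_one (norm_pos_iff.2 (hden0 z hz)), ← sq_lt_sq₀ (norm_nonneg _) (norm_nonneg _),
      Complex.sq_norm, Complex.sq_norm]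
    linarith
  have hS0 : S 0 = 0 := by simp [hS]
  have hSz : ∀ z ∈ ball (0 : ℂ) 1, ‖S z‖ ≤ ‖z‖ := fun z hz =>
    Complex.norm_le_norm_of_mapsTo_ball hSd (hS1.mono_right ball_subset_closedBall) hS0
      (by simpa using hz)
  have hpd : HasDerivAt p (deriv p 0) 0 := (hp.differentiableAt (ball_mem_nhds 0 one_pos)).hasDerivAt
  have hden00 : den 0 = -2 * a := by
    apply Complex.ext <;> simp [hden, ha]; ring
  have hSderiv : deriv S 0 = deriv p 0 / den 0 := by
    have h2 := (hpd.sub_const (p 0)).div (hpd.add_const (starRingEnd ℂ (p 0))) (hden0 0 hmem0)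
    rw [show S = (fun z => p z - p 0) / (fun z => p z + starRingEnd ℂ (p 0)) from rfl, h2.deriv]
    have := hden0 0 hmem0
    simp only [hden] at this ⊢
    field_simp
    simp
  have hS'le : ‖deriv S 0‖ ≤ 1 := by
    have := Complex.norm_deriv_le_div_of_mapsTo_ball hSd (R₂ := 1)
      (by rw [hS0]; exact hS1.mono_right ball_subset_closedBall) one_pos
    simpa using this
  have hp'le : ‖deriv p 0‖ ≤ 2 * a := by
    rw [hSderiv, norm_div, hden00, div_le_one (by simp [ha0.ne'])] at hS'le
    simpa [abs_of_pos ha0] using hS'le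
  have hH0 : deriv H 0 = deriv p 0 * H 0 := by
    have he : H =ᶠ[𝓝 0] fun z => Complex.exp (p z) := by
      filter_upwards [ball_mem_nhds (0 : ℂ) one_pos] with z hz using hHp z hz
    rw [he.deriv_eq, hpd.cexp.deriv, hHp 0 hmem0]
    ring
  -- the Harnack inequality along the radius towards `1`
  have hharn : ∀ s : ℝ, s ∈ Ioo (0 : ℝ) 1 → (p s).re ≤ -(a * (1 - s) / 2) := by
    intro s hs
    have hmem : (s : ℂ) ∈ ball (0 : ℂ) 1 := by
      simp [abs_of_pos hs.1, hs.2]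
    have hle := hSz s hmem
    rw [Complex.norm_real, Real.norm_of_nonneg hs.1.le] at hle
    have hdpos := norm_pos_iff.2 (hden0 s hmem)
    simp only [hS, norm_div] at hle
    rw [div_le_iff₀ hdpos] at hle
    have h4 := hsq s
    rw [← Complex.sq_norm, ← Complex.sq_norm] at h4
    -- `p 0 + conj (p 0) = den - (p - p 0)`
    have h5 : 2 * a ≤ (1 + s) * ‖den s‖ := by
      have h6 : (den s - (p s - p 0)) = -2 * a := by
        apply Complex.ext <;> simp [hden, ha]; ring
      have h7 := norm_sub_le (den s) (p s - p 0)
      rw [h6] at h7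
      simp [abs_of_pos ha0] at h7
      linarith
    have h8 : (1 - s ^ 2) * ‖den s‖ ^ 2 ≤ 4 * (p s).re * (p 0).re := by
      have : ‖p s - p 0‖ ^ 2 ≤ (s * ‖den s‖) ^ 2 := by gcongr
      nlinarith
    have h9 : (2 * a) ^ 2 ≤ ((1 + s) * ‖den s‖) ^ 2 := by gcongr
    have h10 : (1 - s) * (2 * a) ^ 2 ≤ (1 + s) * (4 * (p s).re * (p 0).re) := by
      have h11 : (1 - s) * (2 * a) ^ 2 ≤ (1 - s) * ((1 + s) * ‖den s‖) ^ 2 :=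
        mul_le_mul_of_nonneg_left h9 (by linarith [hs.2])
      have h12 := mul_le_mul_of_nonneg_left h8 (show 0 ≤ 1 + s by linarith [hs.1])
      nlinarith
    have h13 : (p 0).re = -a := by rw [ha]; ring
    rw [h13] at h10
    have h14 : (1 - s) * a ≤ -((1 + s) * (p s).re) := by
      by_contra hcon
      push Not at hcon
      nlinarith
    have h15 := hre s hmem
    nlinarith [hs.2]
  have hkey : a / 2 ≤ ‖D‖ := by
    have hH : HasDerivAt (fun s : ℝ => H s) D 1 := by
      have hD' : HasDerivAt H D ((1 : ℝ) : ℂ) := by simpa using hD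
      exact hD'.comp_ofReal
    have hE : HasDerivAt (fun s : ℝ => Real.exp (-(a * (1 - s) / 2))) (a / 2) 1 := by
      have h2 : HasDerivAt (fun s : ℝ => -(a * (1 - s) / 2)) (a / 2) 1 := by
        have := ((((hasDerivAt_id (1 : ℝ)).const_sub 1).const_mul a).div_const 2).neg
        convert! this using 1
        ring
      simpa using h2.exp
    have t1 := (hasDerivAt_iff_tendsto_slope.1 hH).norm
    have t2 := hasDerivAt_iff_tendsto_slope.1 hE
    have hsub : 𝓝[<] (1 : ℝ) ≤ 𝓝[≠] 1 := nhdsWithin_mono _ (fun x hx => ne_of_lt hx)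
    refine le_of_tendsto_of_tendsto (t2.mono_left hsub) (t1.mono_left hsub) ?_
    filter_upwards [Ioo_mem_nhdsLT (zero_lt_one (α := ℝ))] with s hs
    have hmem : (s : ℂ) ∈ ball (0 : ℂ) 1 := by
      simp [abs_of_pos hs.1, hs.2]
    have hHs : ‖H s‖ ≤ Real.exp (-(a * (1 - s) / 2)) := by
      rw [hHp s hmem, Complex.norm_exp]
      exact Real.exp_le_exp.2 (hharn s hs)
    have h1s : 0 < 1 - s := by linarith [hs.2]
    rw [slope_def_field, slope_def_module, norm_smul, norm_inv, Real.norm_eq_abs,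
      abs_sub_comm, abs_of_pos h1s, norm_sub_rev]
    have htri := norm_sub_norm_le (H 1) (H s)
    rw [hH1] at htri
    rw [show s - 1 = -(1 - s) by ring, div_neg, ← neg_div, div_eq_inv_mul]
    simp only [sub_self, mul_zero, zero_div, neg_zero, Real.exp_zero, Complex.ofReal_one]
    gcongr
    linarith
  rw [hH0, norm_mul]
  gcongr
  linarith

theorem norm_deriv_le_of_ball {h : ℂ → ℂ} {z ζ : ℂ} {r : ℝ} (hr : 0 < r)
    (hd : DifferentiableOn ℂ h (ball z r)) (h0 : ∀ w ∈ ball z r, h w ≠ 0)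
    (h1 : ∀ w ∈ ball z r, ‖h w‖ < 1) (hζ : dist ζ z = r) (hdζ : DifferentiableAt ℂ h ζ)
    (hhζ : ‖h ζ‖ = 1) : ‖deriv h z‖ ≤ 4 * ‖deriv h ζ‖ * ‖h z‖ := by
  have hn : ‖ζ - z‖ = r := by rw [← dist_eq_norm, hζ]
  set l : ℂ → ℂ := fun t => z + t * (ζ - z) with hl
  have hld : ∀ t, HasDerivAt l (ζ - z) t := fun t => by
    have := ((hasDerivAt_id t).mul_const (ζ - z)).const_add z
    rw [one_mul] at this
    exact this
  have hmaps : MapsTo l (ball 0 1) (ball z r) := by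
    intro t ht
    rw [mem_ball_zero_iff] at ht
    rw [mem_ball, dist_eq_norm, hl]
    simp only [add_sub_cancel_left, norm_mul, hn]
    nlinarith
  have hl0 : l 0 = z := by simp [hl]
  have hl1 : l 1 = ζ := by simp [hl]
  have hD0 : HasDerivAt (h ∘ l) (deriv h z * (ζ - z)) 0 := by
    refine HasDerivAt.comp 0 ?_ (hld 0)
    rw [hl0]
    exact (hd.differentiableAt (ball_mem_nhds z hr)).hasDerivAt
  have hD1 : HasDerivAt (h ∘ l) (deriv h ζ * (ζ - z)) 1 := by
    refine HasDerivAt.comp 1 ?_ (hld 1)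
    rw [hl1]
    exact hdζ.hasDerivAt
  have := norm_deriv_zero_le_of_unit_disc (H := h ∘ l)
    (hd.comp (fun t _ => (hld t).differentiableAt.differentiableWithinAt) hmaps)
    (fun t ht => h0 _ (hmaps ht)) (fun t ht => h1 _ (hmaps ht)) hD1 (by simp [hl1, hhζ])
  rw [hD0.deriv] at this
  simp only [norm_mul, hn, Function.comp_apply, hl0] at this
  have h3 : r * ‖deriv h z‖ ≤ r * (4 * ‖deriv h ζ‖ * ‖h z‖) := by linarith
  exact le_of_mul_le_mul_left h3 hr

theorem norm_deriv_le_two_mul_norm {g : ℂ → ℂ} (hg : Differentiable ℂ g) {z₀ z : ℂ} {ρ M : ℝ}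
    (hz₀ : ‖g z₀‖ ≤ 2) (hM : ∀ w, ‖g w‖ ≤ 2 → dist w z₀ ≤ 2 * ρ → ‖deriv g w‖ ≤ M)
    (hz : dist z z₀ ≤ ρ) (hgz : 2 < ‖g z‖) : ‖deriv g z‖ ≤ 2 * M * ‖g z‖ := by
  have hE : IsClosed {w | ‖g w‖ ≤ 2} := isClosed_le hg.continuous.norm continuous_const
  obtain ⟨ζ, hζE, hζ⟩ := hE.exists_infDist_eq_dist ⟨z₀, hz₀⟩ z
  replace hζE : ‖g ζ‖ ≤ 2 := hζE
  set r := dist z ζ with hr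
  have hr0 : 0 < r := by
    rw [hr, dist_pos]
    rintro rfl
    linarith
  have hrz : r ≤ dist z z₀ := by
    rw [← hζ]; exact infDist_le_dist_of_mem (show z₀ ∈ {w | ‖g w‖ ≤ 2} from hz₀)
  have hout : ∀ w ∈ ball z r, 2 < ‖g w‖ := by
    intro w hw
    by_contra hcon
    push Not at hcon
    have := infDist_le_dist_of_mem (x := z) (show w ∈ {w | ‖g w‖ ≤ 2} from hcon)
    rw [hζ, dist_comm z w] at this
    exact absurd (mem_ball.1 hw) (not_lt.2 this)
  have hζ2 : ‖g ζ‖ = 2 := by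
    refine le_antisymm hζE ?_
    have hcl : ζ ∈ closure (ball z r) := by
      rw [closure_ball z hr0.ne']
      simp [hr, dist_comm]
    have hsub : closure (ball z r) ⊆ {w | 2 ≤ ‖g w‖} :=
      closure_minimal (fun w hw => (hout w hw).le) (isClosed_le continuous_const hg.continuous.norm)
    exact hsub hcl
  have hne : ∀ w, 2 ≤ ‖g w‖ → g w ≠ 0 := by
    intro w hw h
    rw [h, norm_zero] at hw
    linarith
  have hder : ∀ w, 2 ≤ ‖g w‖ → HasDerivAt (fun w => 2 / g w) (-(2 * deriv g w) / g w ^ 2) w := by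
    intro w hw
    convert! (hasDerivAt_const w (2 : ℂ)).div (hg w).hasDerivAt (hne w hw) using 1
    ring
  have key := norm_deriv_le_of_ball (h := fun w => 2 / g w) hr0
    (fun w hw => (hder w (hout w hw).le).differentiableAt.differentiableWithinAt)
    (fun w hw => div_ne_zero two_ne_zero (hne w (hout w hw).le))
    (fun w hw => by
      have := hout w hw
      rw [norm_div, div_lt_one (by linarith)]
      simpa using this)
    (by rw [hr, dist_comm]) (hder ζ hζ2.ge).differentiableAt (by simp [hζ2])
  rw [(hder z hgz.le).deriv, (hder ζ hζ2.ge).deriv] at key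
  simp only [norm_div, norm_neg, norm_mul, norm_pow, hζ2, Complex.norm_ofNat] at key
  have hMζ := hM ζ hζE (by
    have := dist_triangle ζ z z₀
    rw [dist_comm ζ z] at this
    linarith)
  have hgp : 0 < ‖g z‖ := by linarith
  rw [div_le_iff₀ (by positivity)] at key
  have : 4 * (2 * ‖deriv g ζ‖ / 2 ^ 2) * (2 / ‖g z‖) * ‖g z‖ ^ 2
      = 4 * ‖deriv g ζ‖ * ‖g z‖ := by
    field_simp
  rw [this] at key
  have := mul_le_mul_of_nonneg_right hMζ hgp.le
  linarith

theorem norm_deriv_le_one_add_norm {g : ℂ → ℂ} (hg : Differentiable ℂ g) {z₀ z : ℂ} {ρ M : ℝ}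
    (hz₀ : ‖g z₀‖ ≤ 2) (hM : ∀ w, ‖g w‖ ≤ 2 → dist w z₀ ≤ 2 * ρ → ‖deriv g w‖ ≤ M)
    (hz : dist z z₀ ≤ ρ) : ‖deriv g z‖ ≤ 2 * M * (1 + ‖g z‖) := by
  have hρ : 0 ≤ ρ := dist_nonneg.trans hz
  have hM0 : 0 ≤ M := (norm_nonneg _).trans (hM z₀ hz₀ (by simpa using hρ))
  have hn := norm_nonneg (g z)
  rcases le_or_gt ‖g z‖ 2 with h | h
  · have := hM z h (by linarith)
    nlinarith
  · have := norm_deriv_le_two_mul_norm hg hz₀ hM hz h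
    nlinarith

theorem exists_tendstoLocallyUniformlyOn_hyperfilter {G : ℕ → ℂ → ℂ}
    (hG : ∀ k, Differentiable ℂ (G k)) {B : ℝ → ℝ}
    (hB : ∀ R, ∀ᶠ k in atTop, ∀ z, ‖z‖ ≤ R → ‖G k z‖ ≤ B R) :
    ∃ h : ℂ → ℂ, TendstoLocallyUniformlyOn G h (hyperfilter ℕ : Filter ℕ) univ := by
  have hle : (hyperfilter ℕ : Filter ℕ) ≤ atTop := Nat.hyperfilter_le_atTop
  have hlim : ∀ z, ∃ y, Tendsto (fun k => G k z) (hyperfilter ℕ) (𝓝 y) := by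
    intro z
    have hmem : (hyperfilter ℕ).map (fun k => G k z) ≤ 𝓟 (closedBall (0 : ℂ) (B ‖z‖)) := by
      rw [le_principal_iff]
      change ∀ᶠ k in (hyperfilter ℕ : Filter ℕ), G k z ∈ closedBall (0 : ℂ) (B ‖z‖)
      filter_upwards [(hB ‖z‖).filter_mono hle] with k hk
      simpa using hk z le_rfl
    obtain ⟨y, -, hy⟩ := (isCompact_closedBall (0 : ℂ) (B ‖z‖)).ultrafilter_le_nhds _ hmem
    exact ⟨y, hy⟩
  choose h hh using hlim
  refine ⟨h, ?_⟩
  rw [tendstoLocallyUniformlyOn_univ, Metric.tendstoLocallyUniformly_iff]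
  intro ε hε z
  obtain ⟨L, hL0, hL⟩ : ∃ L > 0, ∀ᶠ k in atTop, ∀ w ∈ ball z 1, ‖G k w - G k z‖ ≤ L * ‖w - z‖ := by
    refine ⟨max (B (‖z‖ + 2)) 1, by positivity, ?_⟩
    filter_upwards [hB (‖z‖ + 2)] with k hk w hw
    refine (convex_ball z 1).norm_image_sub_le_of_norm_deriv_le (fun x _ => hG k x)
      (fun x hx => ?_) (by simp) hw
    refine (Complex.norm_deriv_le_of_forall_mem_sphere_norm_le (C := B (‖z‖ + 2)) one_pos
      (hG k).diffContOnCl fun y hy => hk y ?_).trans ?_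
    · rw [mem_ball, dist_eq_norm] at hx
      rw [mem_sphere, dist_eq_norm] at hy
      have h1 := norm_le_norm_add_norm_sub' y x
      have h2 := norm_le_norm_add_norm_sub' x z
      linarith
    · simp
  have hLh : ∀ w ∈ ball z 1, ‖h w - h z‖ ≤ L * ‖w - z‖ := by
    intro w hw
    refine le_of_tendsto ((hh w).sub (hh z)).norm ?_
    filter_upwards [hL.filter_mono hle] with k hk using hk w hw
  refine ⟨ball z (min 1 (ε / (4 * L))), ball_mem_nhds z (by positivity), ?_⟩
  filter_upwards [hL.filter_mono hle, Metric.tendsto_nhds.1 (hh z) (ε / 4) (by positivity)] with k hk hkz w hw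
  rw [mem_ball, lt_min_iff, lt_div_iff₀ (by positivity), dist_eq_norm] at hw
  have hw1 : w ∈ ball z 1 := by rw [mem_ball, dist_eq_norm]; exact hw.1
  have e1 := hk w hw1
  have e2 := hLh w hw1
  rw [dist_eq_norm] at hkz ⊢
  have e3 : h w - G k w = (h w - h z) - (G k w - G k z) - (G k z - h z) := by ring
  rw [e3]
  have e4 := norm_sub_le ((h w - h z) - (G k w - G k z)) (G k z - h z)
  have e5 := norm_sub_le (h w - h z) (G k w - G k z)
  nlinarith

theorem TendstoLocallyUniformlyOn.eventually_norm_sub_lt {ι : Type*} {l : Filter ι}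
    {G : ι → ℂ → ℂ} {h : ℂ → ℂ} (hlim : TendstoLocallyUniformlyOn G h l univ) {S : Set ℂ}
    (hS : IsCompact S) {η : ℝ} (hη : 0 < η) : ∀ᶠ k in l, ∀ z ∈ S, ‖h z - G k z‖ < η := by
  have := (tendstoLocallyUniformlyOn_iff_forall_isCompact isOpen_univ).1 hlim S (subset_univ _) hS
  filter_upwards [Metric.tendstoUniformlyOn_iff.1 this η hη] with k hk z hz
  simpa [dist_eq_norm] using hk z hz

theorem limit_pow_ne_one {ι : Type*} {l : Filter ι} [NeBot l] {G K : ι → ℂ → ℂ} {h : ℂ → ℂ}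
    {ε : ι → ℂ} {n : ℕ} (hn : n ≠ 0)
    (hG : ∀ k, Differentiable ℂ (G k)) (hK : ∀ k, Differentiable ℂ (K k))
    (hlim : TendstoLocallyUniformlyOn G h l univ) (hε : Tendsto ε l (𝓝 0))
    (hGK : ∀ k z, n * deriv (G k) z - ε k * G k z = K k z * (G k z ^ n - 1))
    {z₀ : ℂ} (hne : deriv h z₀ ≠ 0) (t : ℂ) : h t ^ n ≠ 1 := by
  intro ht
  have hh : Differentiable ℂ h := differentiableOn_univ.1
    (hlim.differentiableOn (Eventually.of_forall fun k => (hG k).differentiableOn) isOpen_univ)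
  have hlim' : TendstoLocallyUniformlyOn (deriv ∘ G) (deriv h) l univ :=
    hlim.deriv (Eventually.of_forall fun k => (hG k).differentiableOn) isOpen_univ
  have hlimp : TendstoLocallyUniformlyOn (fun k z => G k z ^ n) (fun z => h z ^ n) l univ := by
    clear hGK ht hn
    induction n with
    | zero =>
      simp only [pow_zero]
      rw [tendstoLocallyUniformlyOn_univ, Metric.tendstoLocallyUniformly_iff]
      exact fun η hη x => ⟨univ, univ_mem, by simp [hη]⟩
    | succ n ih =>
      simp only [pow_succ]
      exact ih.mul₀ hlim (hh.continuous.pow n).continuousOn hh.continuous.continuousOn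
  set y : ℂ → ℂ := fun z => h z ^ n - 1 with hy
  have hyd : ∀ z, HasDerivAt y (n * h z ^ (n - 1) * deriv h z) z := fun z =>
    ((hh z).hasDerivAt.pow n).sub_const 1
  have hyan : AnalyticOnNhd ℂ y univ :=
    (DifferentiableOn.analyticOnNhd (fun z _ => (hyd z).differentiableAt.differentiableWithinAt)
      isOpen_univ)
  have hpunct : ∀ᶠ z in 𝓝[≠] t, y z ≠ 0 := by
    refine (hyan t trivial).eventually_eq_zero_or_eventually_ne_zero.resolve_left fun hev => ?_
    have hy0 : y = 0 := hyan.eq_of_eventuallyEq (fun z _ => analyticAt_const) hev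
    have h1 : h z₀ ≠ 0 := by
      intro h0
      have := congrFun hy0 z₀
      simp [hy, h0, hn] at this
    have h2 := (hyd z₀).deriv
    rw [hy0, show (0 : ℂ → ℂ) = fun _ => 0 from rfl, deriv_const] at h2
    exact mul_ne_zero (mul_ne_zero (Nat.cast_ne_zero.2 hn) (pow_ne_zero _ h1)) hne h2.symm
  obtain ⟨s, hs, hsy⟩ : ∃ s > 0, ∀ z, dist z t = s → y z ≠ 0 := by
    rw [eventually_nhdsWithin_iff, Metric.eventually_nhds_iff] at hpunct
    obtain ⟨r, hr, hrz⟩ := hpunct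
    refine ⟨r / 2, by positivity, fun z hz => hrz (by linarith) ?_⟩
    rintro rfl
    rw [dist_self] at hz
    linarith
  have hcl : IsCompact (closedBall t s) := isCompact_closedBall t s
  have hsp : IsCompact (sphere t s) := isCompact_sphere t s
  obtain ⟨w, hw⟩ : (sphere t s).Nonempty := NormedSpace.sphere_nonempty.2 hs.le
  obtain ⟨δ, hδ, hδy⟩ : ∃ δ > 0, ∀ z ∈ sphere t s, 2 * δ ≤ ‖y z‖ := by
    obtain ⟨x, hx, hmin⟩ := hsp.exists_isMinOn ⟨w, hw⟩
      (f := fun z => ‖y z‖) (fun z _ => (hyd z).continuousAt.norm.continuousWithinAt)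
    refine ⟨‖y x‖ / 2, half_pos (norm_pos_iff.2 (hsy x hx)), fun z hz => ?_⟩
    have : ‖y x‖ ≤ ‖y z‖ := hmin hz
    linarith
  obtain ⟨H, hH⟩ := hcl.exists_bound_of_continuousOn hh.continuous.continuousOn
  obtain ⟨H', hH'⟩ := hcl.exists_bound_of_continuousOn hh.deriv.continuous.continuousOn
  set N : ℝ := n * (H' + 1) + (H + 1) with hN
  have hKb : ∀ᶠ k in l, ∀ z ∈ closedBall t s, ‖K k z‖ ≤ N / δ := by
    filter_upwards [hlim.eventually_norm_sub_lt hcl one_pos,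
      hlim'.eventually_norm_sub_lt hcl one_pos, hlimp.eventually_norm_sub_lt hcl hδ,
      Metric.tendsto_nhds.1 hε 1 one_pos] with k h1 h2 h3 h4 z hz
    refine Complex.norm_le_of_forall_mem_frontier_norm_le isBounded_ball
      (hK k).diffContOnCl (fun x hx => ?_) (U := ball t s) (by rwa [closure_ball t hs.ne'])
    rw [frontier_ball t hs.ne'] at hx
    have hxc : x ∈ closedBall t s := sphere_subset_closedBall hx
    have e1 : ‖G k x‖ ≤ H + 1 := by
      have := norm_le_norm_add_norm_sub (h x) (G k x)
      linarith [h1 x hxc, hH x hxc]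
    have e2 : ‖deriv (G k) x‖ ≤ H' + 1 := by
      have := norm_le_norm_add_norm_sub (deriv h x) (deriv (G k) x)
      have h5 := h2 x hxc
      simp only [Function.comp_apply] at h5
      linarith [hH' x hxc]
    have e3 : δ ≤ ‖G k x ^ n - 1‖ := by
      have h5 := h3 x hxc
      have h6 := norm_le_norm_add_norm_sub' (y x) (G k x ^ n - 1)
      have h7 : y x - (G k x ^ n - 1) = h x ^ n - G k x ^ n := by simp [hy]
      rw [h7] at h6
      linarith [hδy x hx]
    have e4 : ‖n * deriv (G k) x - ε k * G k x‖ ≤ N := by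
      refine (norm_sub_le _ _).trans ?_
      rw [norm_mul, norm_mul, Complex.norm_natCast]
      have h8 : ‖ε k‖ ≤ 1 := by simpa using h4.le
      have h9 : ‖ε k‖ * ‖G k x‖ ≤ 1 * (H + 1) := by gcongr
      have h10 : (n : ℝ) * ‖deriv (G k) x‖ ≤ n * (H' + 1) := by gcongr
      linarith
    rw [hGK, norm_mul] at e4
    rw [le_div_iff₀ hδ]
    exact (mul_le_mul_of_nonneg_left e3 (norm_nonneg _)).trans e4
  have hbound : ∀ z ∈ closedBall t s, ‖n * deriv h z‖ ≤ N / δ * ‖y z‖ := by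
    intro z hz
    have t1 := hlim.tendsto_at (mem_univ z)
    have t2 := hlim'.tendsto_at (mem_univ z)
    have t3 : Tendsto (fun k => n * deriv (G k) z - ε k * G k z) l (𝓝 (n * deriv h z)) := by
      simpa using (t2.const_mul (n : ℂ)).sub (hε.mul t1)
    refine le_of_tendsto_of_tendsto t3.norm (((t1.pow n).sub_const 1).norm.const_mul (N / δ)) ?_
    filter_upwards [hKb] with k hk
    rw [hGK, norm_mul]
    exact mul_le_mul_of_nonneg_right (hk z hz) (norm_nonneg _)
  refine hsy w hw (eq_zero_of_norm_deriv_le (f := y) (c := t) (C := H ^ (n - 1) * (N / δ))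
    (fun z => (hyd z).differentiableAt) (by simp [hy, ht]) fun z hz => ?_)
  have hzc : z ∈ closedBall t s := by rwa [mem_sphere.1 hw] at hz
  rw [(hyd z).deriv, show (n : ℂ) * h z ^ (n - 1) * deriv h z = h z ^ (n - 1) * (n * deriv h z) by
    ring, norm_mul, norm_pow, mul_assoc]
  have h1 := hH z hzc
  have h2 := hbound z hzc
  have h3 : 0 ≤ H := (norm_nonneg _).trans h1
  gcongr

theorem exists_bound_deriv_of_norm_le_two {g K : ℂ → ℂ} (hg : Differentiable ℂ g)
    (hK : Differentiable ℂ K) {n : ℕ} (hn : 2 ≤ n)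
    (hgK : ∀ z, n * deriv g z - g z = K z * (g z ^ n - 1)) :
    ∃ C, ∀ z, ‖g z‖ ≤ 2 → ‖deriv g z‖ ≤ C := by
  by_contra! hcon
  have hE : IsClosed {w | ‖g w‖ ≤ 2} := isClosed_le hg.continuous.norm continuous_const
  have hpick : ∀ k : ℕ, ∃ z, ‖g z‖ ≤ 2 ∧ (k + 1 : ℝ) < ‖deriv g z‖ ∧ ∀ w, ‖g w‖ ≤ 2 →
      dist w z * ‖deriv g z‖ ≤ k + 1 → ‖deriv g w‖ ≤ 2 * ‖deriv g z‖ := by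
    intro k
    obtain ⟨x, hx, hxk⟩ := hcon (2 * (k + 1))
    obtain ⟨z, hz, hz1, hz2⟩ := exists_almost_maximal hE (q := fun z => ‖deriv g z‖)
      hg.deriv.continuous.norm (N := k + 1) (by positivity) hx hxk
    exact ⟨z, hz, hz1, hz2⟩
  choose Z hZ hZ1 hZ2 using hpick
  set M : ℕ → ℝ := fun k => ‖deriv g (Z k)‖ with hM
  have hMpos : ∀ k, 0 < M k := fun k => lt_trans (by positivity) (hZ1 k)
  have hMne : ∀ k, (M k : ℂ) ≠ 0 := fun k => Complex.ofReal_ne_zero.2 (hMpos k).ne'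
  set G : ℕ → ℂ → ℂ := fun k z => g (Z k + z / M k) with hG
  have hGder : ∀ k z, HasDerivAt (G k) (deriv g (Z k + z / M k) / M k) z := by
    intro k z
    have h1 : HasDerivAt (fun z : ℂ => Z k + z / M k) (1 / M k) z :=
      ((hasDerivAt_id z).div_const _).const_add _
    have := (hg (Z k + z / M k)).hasDerivAt.comp z h1
    rwa [mul_one_div] at this
  have hGd : ∀ k, Differentiable ℂ (G k) := fun k z => (hGder k z).differentiableAt
  have hGbound : ∀ (k : ℕ) (z : ℂ), ‖z‖ ≤ (k + 1) / 2 → ‖deriv (G k) z‖ ≤ 4 * (1 + ‖G k z‖) := by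
    intro k z hz
    have hMk := hMpos k
    have := norm_deriv_le_one_add_norm hg (z₀ := Z k) (z := Z k + z / M k)
      (ρ := (k + 1) / 2 / M k) (M := 2 * M k) (hZ k) (fun w hw hd => hZ2 k w hw ?_) ?_
    · rw [(hGder k z).deriv, norm_div, Complex.norm_real, Real.norm_of_nonneg hMk.le,
        div_le_iff₀ hMk]
      linarith
    · calc dist w (Z k) * M k ≤ 2 * ((k + 1) / 2 / M k) * M k := by gcongr
        _ = k + 1 := by field_simp
    · rw [dist_eq_norm, add_sub_cancel_left, norm_div, Complex.norm_real,
        Real.norm_of_nonneg hMk.le]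
      gcongr
  have hGgrowth : ∀ (k : ℕ) (z : ℂ), ‖z‖ ≤ (k + 1) / 2 → ‖G k z‖ ≤ 3 * Real.exp (4 * ‖z‖) := by
    intro k z hz
    have := norm_le_exp_of_norm_deriv_le (hGd k) (c := 0) (z := z) (C := 4) (by norm_num)
      (fun w hw => hGbound k w (by simp only [dist_zero_right] at hw; linarith))
    rw [dist_zero_right] at this
    refine this.trans ?_
    have h0 : ‖G k 0‖ ≤ 2 := by simpa [hG] using hZ k
    gcongr
    linarith
  have hbig : ∀ R : ℝ, ∀ᶠ k : ℕ in atTop, R ≤ (k + 1) / 2 := by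
    intro R
    filter_upwards [eventually_ge_atTop ⌈2 * R⌉₊] with k hk
    have := (Nat.le_ceil (2 * R)).trans (Nat.cast_le.2 hk)
    linarith
  obtain ⟨h, hlim⟩ := exists_tendstoLocallyUniformlyOn_hyperfilter hGd
    (B := fun R => 3 * Real.exp (4 * R)) (fun R => by
      filter_upwards [hbig R] with k hk z hz
      refine (hGgrowth k z (hz.trans hk)).trans ?_
      gcongr)
  have hle : (hyperfilter ℕ : Filter ℕ) ≤ atTop := Nat.hyperfilter_le_atTop
  have hh : Differentiable ℂ h := differentiableOn_univ.1
    (hlim.differentiableOn (Eventually.of_forall fun k => (hGd k).differentiableOn) isOpen_univ)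
  have hlim' : TendstoLocallyUniformlyOn (deriv ∘ G) (deriv h) (hyperfilter ℕ : Filter ℕ) univ :=
    hlim.deriv (Eventually.of_forall fun k => (hGd k).differentiableOn) isOpen_univ
  have hh1 : ‖deriv h 0‖ = 1 := by
    refine tendsto_nhds_unique (hlim'.tendsto_at (mem_univ 0)).norm
      (tendsto_const_nhds.congr fun k => ?_)
    rw [Function.comp_apply, (hGder k 0).deriv, norm_div, Complex.norm_real,
      Real.norm_of_nonneg (hMpos k).le, zero_div, add_zero]
    exact (div_self (hMpos k).ne').symm
  have hhne : deriv h 0 ≠ 0 := by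
    intro h0
    simp [h0] at hh1
  have hgrowth : ∀ z, ‖h z‖ ≤ 3 * Real.exp (4 * ‖z‖) := by
    intro z
    refine le_of_tendsto (hlim.tendsto_at (mem_univ z)).norm ?_
    filter_upwards [(hbig ‖z‖).filter_mono hle] with k hk using hGgrowth k z hk
  have hMinv : Tendsto (fun k => (1 / M k : ℂ)) (hyperfilter ℕ : Filter ℕ) (𝓝 0) := by
    rw [tendsto_zero_iff_norm_tendsto_zero]
    refine (squeeze_zero (fun _ => norm_nonneg _) (fun k => ?_)
      tendsto_one_div_add_atTop_nhds_zero_nat).mono_left hle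
    rw [norm_div, norm_one, Complex.norm_real, Real.norm_of_nonneg (hMpos k).le]
    gcongr
    exact (hZ1 k).le
  have homit := limit_pow_ne_one (n := n) (by omega) hGd
    (K := fun k z => K (Z k + z / M k) / M k)
    (fun k z => (hK.comp (((differentiable_id).div_const _).const_add _) z).div_const _)
    hlim hMinv (fun k z => by
      rw [(hGder k z).deriv]
      have h1 := hgK (Z k + z / M k)
      have h2 := hMne k
      simp only [hG]
      generalize Z k + z / (M k : ℂ) = w at h1 ⊢
      field_simp
      linear_combination h1) hhne
  -- two distinct omitted values
  obtain ⟨ω, hω, hω1⟩ : ∃ ω : ℂ, ω ^ n = 1 ∧ ω ≠ 1 :=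
    have hprim := Complex.isPrimitiveRoot_exp n (by omega)
    ⟨_, hprim.pow_eq_one, hprim.ne_one (by omega)⟩
  obtain ⟨a, b, hab⟩ := exists_eq_exp_linear (A := fun z => h z - 1) (hh.sub_const 1)
    (fun z hz => homit z (by rw [sub_eq_zero.1 hz, one_pow])) (B := 4) (C := 4)
    (by norm_num) (by norm_num) (fun z => by
      have h1 := hgrowth z
      have h2 : 1 ≤ Real.exp (4 * ‖z‖) := Real.one_le_exp (by positivity)
      have h3 := norm_sub_le (h z) 1
      rw [norm_one] at h3
      linarith)
  by_cases ha : a = 0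
  · apply hhne
    have : h = fun _ => Complex.exp b + 1 := by
      funext z
      have := hab z
      rw [ha, zero_mul, zero_add] at this
      linear_combination this
    rw [this, deriv_const]
  · refine homit ((Complex.log (ω - 1) - b) / a) ?_
    have := hab ((Complex.log (ω - 1) - b) / a)
    rw [mul_div_cancel₀ _ ha, sub_add_cancel, Complex.exp_log (sub_ne_zero.2 hω1)] at this
    rw [sub_left_inj.1 this, hω]

theorem exists_norm_deriv_le_one_add_norm {g : ℂ → ℂ} (hg : Differentiable ℂ g)
    (hnc : ¬∃ c, ∀ z, g z = c) (h : ∃ C, ∀ z, ‖g z‖ ≤ 2 → ‖deriv g z‖ ≤ C) :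
    ∃ C, 0 < C ∧ ∀ z, ‖deriv g z‖ ≤ C * (1 + ‖g z‖) := by
  obtain ⟨C, hC⟩ := h
  obtain ⟨z₀, hz₀⟩ : ∃ z₀, ‖g z₀‖ ≤ 2 := by
    by_contra! hcon
    have hne : ∀ z, g z ≠ 0 := fun z h0 => by
      have := hcon z
      rw [h0, norm_zero] at this
      linarith
    have hb : Bornology.IsBounded (range fun z => (g z)⁻¹) := by
      refine isBounded_iff_forall_norm_le.2 ⟨2⁻¹, ?_⟩
      rintro _ ⟨z, rfl⟩
      rw [norm_inv]
      exact inv_anti₀ two_pos (hcon z).le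
    refine hnc ⟨g 0, fun z => inv_injective ?_⟩
    exact (hg.inv hne).apply_eq_apply_of_bounded hb z 0
  refine ⟨2 * (|C| + 1), by positivity, fun z => ?_⟩
  exact norm_deriv_le_one_add_norm hg hz₀
    (fun w hw _ => (hC w hw).trans ((le_abs_self C).trans (by linarith))) le_rfl

theorem half_dist_le_norm_sub_one {F : ℂ → ℂ} (hF : Differentiable ℂ F) {ζ t : ℂ} {M : ℝ}
    (h1 : F ζ = 1) (h2 : deriv F ζ = 1) (hM : ∀ w, dist w ζ ≤ 1 → ‖deriv F w‖ ≤ M)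
    (ht : dist t ζ ≤ 1 / 2) (htM : 4 * M * dist t ζ ≤ 1) : dist t ζ / 2 ≤ ‖F t - 1‖ := by
  set s := dist t ζ with hs
  have hM0 : 0 ≤ M := (norm_nonneg _).trans (hM ζ (by simp))
  have hs0 : 0 ≤ s := dist_nonneg
  have hconv := convex_closedBall ζ s
  have hζm : ζ ∈ closedBall ζ s := mem_closedBall_self hs0
  have htm : t ∈ closedBall ζ s := by simp [hs]
  have hd2 : ∀ w ∈ closedBall ζ s, ‖deriv (deriv F) w‖ ≤ M / (1 / 2) := by
    intro w hw
    refine Complex.norm_deriv_le_of_forall_mem_sphere_norm_le (by norm_num)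
      hF.deriv.diffContOnCl fun x hx => hM x ?_
    have := dist_triangle x w ζ
    rw [mem_sphere] at hx
    rw [mem_closedBall] at hw
    linarith
  have hd0 : ∀ w, HasDerivAt (fun x => F x - x) (deriv F w - 1) w :=
    fun w => (hF w).hasDerivAt.sub (hasDerivAt_id w)
  have hd1 : ∀ w ∈ closedBall ζ s, ‖deriv (fun x => F x - x) w‖ ≤ 1 / 2 := by
    intro w hw
    have h3 := hconv.norm_image_sub_le_of_norm_deriv_le (fun x _ => hF.deriv x) hd2 hζm hw
    rw [h2] at h3
    rw [(hd0 w).deriv]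
    refine h3.trans ?_
    rw [mem_closedBall, dist_eq_norm] at hw
    calc M / (1 / 2) * ‖w - ζ‖ ≤ M / (1 / 2) * s := by gcongr
      _ ≤ 1 / 2 := by linarith
  have h4 := hconv.norm_image_sub_le_of_norm_deriv_le
    (fun x _ => (hd0 x).differentiableAt) hd1 hζm htm
  rw [h1, ← dist_eq_norm t ζ, ← hs] at h4
  have h5 : t - ζ = (F t - 1) - (F t - t - (1 - ζ)) := by ring
  have h6 : s ≤ ‖F t - 1‖ + ‖F t - t - (1 - ζ)‖ := by
    rw [hs, dist_eq_norm, h5]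
    exact norm_sub_le _ _
  linarith

theorem exists_norm_le_of_deriv_eq_one {F φ : ℂ → ℂ} (hF : Differentiable ℂ F)
    (hφ : Differentiable ℂ φ) (hF1 : ∀ z, F z = 1 → deriv F z = 1) {N N' M : ℝ} (hM0 : 0 < M)
    (hN0 : 0 ≤ N) (hfar : ∀ δ > 0, ∃ L, ∀ z, δ ≤ ‖F z - 1‖ → ‖φ z‖ ≤ L)
    (hnear : ∀ z, ‖F z - 1‖ ≤ 1 / 2 → ‖φ z * (F z - 1)‖ ≤ N * ‖deriv F z‖)
    (hder : ∀ z, ‖F z - 1‖ ≤ 1 / 2 → ‖deriv F z‖ ≤ N')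
    (hM : ∀ ζ w, F ζ = 1 → dist w ζ ≤ 1 → ‖deriv F w‖ ≤ M) : ∃ L, ∀ z, ‖φ z‖ ≤ L := by
  set s := min (1 / 2) (1 / (4 * M)) with hs
  have hs0 : 0 < s := by positivity
  have hs1 : s ≤ 1 / 2 := min_le_left _ _
  have hs2 : 4 * M * s ≤ 1 := by
    have : s ≤ 1 / (4 * M) := min_le_right _ _
    rwa [le_div_iff₀ (by positivity), mul_comm] at this
  set δ := s / 2 with hδ
  have hδ0 : 0 < δ := by positivity
  obtain ⟨L, hL⟩ := hfar δ hδ0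
  have hcirc : ∀ ζ t, F ζ = 1 → dist t ζ = s → δ ≤ ‖F t - 1‖ := by
    intro ζ t hζ ht
    have := half_dist_le_norm_sub_one hF hζ (hF1 ζ hζ) (fun w hw => hM ζ w hζ hw) (t := t)
      (by rwa [ht]) (by rwa [ht])
    rwa [ht] at this
  set S : Set ℂ := {z | F z = 1} ∪ {z | δ ≤ ‖F z - 1‖} with hS
  have hScl : IsClosed S := (isClosed_eq hF.continuous continuous_const).union
    (isClosed_le continuous_const (hF.continuous.sub continuous_const).norm)
  rcases S.eq_empty_or_nonempty with hemp | hSne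
  · have hlt : ∀ z, F z ≠ 1 ∧ ‖F z - 1‖ < δ := by
      intro z
      have : z ∉ S := by simp [hemp]
      simpa [hS] using this
    have hb : Bornology.IsBounded (range F) := by
      refine isBounded_iff_forall_norm_le.2 ⟨δ + 1, ?_⟩
      rintro _ ⟨z, rfl⟩
      have := norm_le_norm_add_norm_sub' (F z) 1
      rw [norm_one] at this
      linarith [(hlt z).2]
    have hconst : F = fun _ => F 0 := funext fun z => hF.apply_eq_apply_of_bounded hb z 0
    refine ⟨0, fun z => ?_⟩
    have h1 := hnear z (by linarith [(hlt z).2])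
    have h2 : deriv F z = 0 := by rw [hconst, deriv_const]
    rw [h2, norm_zero, mul_zero, norm_mul] at h1
    have h3 : 0 < ‖F z - 1‖ := norm_pos_iff.2 (sub_ne_zero.2 (hlt z).1)
    exact nonpos_of_mul_nonpos_left h1 h3
  refine ⟨max L (N * (4 * (N' / δ))), fun z => ?_⟩
  rcases le_or_gt δ ‖F z - 1‖ with hz | hz
  · exact (hL z hz).trans (le_max_left _ _)
  obtain ⟨ζ, hζS, hζ⟩ := hScl.exists_infDist_eq_dist hSne z
  set r := dist z ζ with hr
  have hmin : ∀ w ∈ S, r ≤ dist z w := fun w hw => hζ ▸ infDist_le_dist_of_mem hw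
  by_cases hζ1 : F ζ = 1
  · refine le_max_of_le_left ?_
    have hrs : r < s := by
      by_contra! hcon
      have hr0 : 0 < r := hs0.trans_le hcon
      have hnr : ‖z - ζ‖ = r := by rw [← dist_eq_norm]
      set t : ℂ := ζ + ((s / r : ℝ) : ℂ) * (z - ζ) with ht
      have h1 : dist t ζ = s := by
        rw [dist_eq_norm, ht, add_sub_cancel_left, norm_mul, Complex.norm_real, hnr,
          Real.norm_of_nonneg (by positivity)]
        field_simp
      have h2 : dist z t = r - s := by
        have : z - t = ((1 - s / r : ℝ) : ℂ) * (z - ζ) := by rw [ht]; push_cast; ring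
        rw [dist_eq_norm, this, norm_mul, Complex.norm_real, hnr, Real.norm_of_nonneg
          (sub_nonneg.2 ((div_le_one hr0).2 hcon))]
        field_simp
      have := hmin t (Or.inr (hcirc ζ t hζ1 h1))
      linarith
    refine Complex.norm_le_of_forall_mem_frontier_norm_le (isBounded_ball (x := ζ) (r := s))
      hφ.diffContOnCl (fun x hx => ?_) (subset_closure (mem_ball.2 hrs))
    rw [frontier_ball ζ hs0.ne'] at hx
    exact hL x (hcirc ζ x hζ1 hx)
  · refine le_max_of_le_right ?_
    have hζδ : δ ≤ ‖F ζ - 1‖ := hζS.resolve_left hζ1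
    have hr0 : 0 < r := dist_pos.2 (by rintro rfl; exact absurd hζδ hz.not_ge)
    have hball : ∀ w ∈ ball z r, F w ≠ 1 ∧ ‖F w - 1‖ < δ := by
      intro w hw
      have : w ∉ S := fun hwS => by
        have := hmin w hwS
        rw [mem_ball, dist_comm] at hw
        linarith
      simpa [hS] using this
    have hζle : ‖F ζ - 1‖ ≤ δ := by
      have hsub : closure (ball z r) ⊆ {w | ‖F w - 1‖ ≤ δ} :=
        closure_minimal (fun w hw => (hball w hw).2.le)
          (isClosed_le (hF.continuous.sub continuous_const).norm continuous_const)
      refine hsub ?_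
      rw [closure_ball z hr0.ne', mem_closedBall, dist_comm]
    have hζeq : ‖F ζ - 1‖ = δ := le_antisymm hζle hζδ
    have hh : ∀ w, HasDerivAt (fun w => (F w - 1) / (δ : ℂ)) (deriv F w / δ) w :=
      fun w => ((hF w).hasDerivAt.sub_const 1).div_const _
    have hδn : ‖(δ : ℂ)‖ = δ := by rw [Complex.norm_real, Real.norm_of_nonneg hδ0.le]
    have hδc : (δ : ℂ) ≠ 0 := Complex.ofReal_ne_zero.2 hδ0.ne'
    have hkey := norm_deriv_le_of_ball hr0
      (fun w _ => (hh w).differentiableAt.differentiableWithinAt)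
      (fun w hw => div_ne_zero (sub_ne_zero.2 (hball w hw).1) hδc)
      (fun w hw => by rw [norm_div, hδn, div_lt_one hδ0]; exact (hball w hw).2)
      (by rw [dist_comm]) (hh ζ).differentiableAt (by rw [norm_div, hδn, hζeq, div_self hδ0.ne'])
    rw [(hh z).deriv, (hh ζ).deriv, norm_div, norm_div, norm_div, hδn, ← mul_div_assoc,
      div_le_div_iff_of_pos_right hδ0] at hkey
    have h1 := hnear z (by linarith)
    have h2 := hder ζ (by linarith)
    have h3 : 0 < ‖F z - 1‖ :=
      norm_pos_iff.2 (sub_ne_zero.2 (hball z (mem_ball_self hr0)).1)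
    refine le_of_mul_le_mul_right ?_ h3
    rw [norm_mul] at h1
    calc ‖φ z‖ * ‖F z - 1‖ ≤ N * ‖deriv F z‖ := h1
      _ ≤ N * (4 * (N' / δ) * ‖F z - 1‖) := by
        gcongr
        exact hkey.trans (by gcongr)
      _ = N * (4 * (N' / δ)) * ‖F z - 1‖ := by ring

theorem exists_eq_const_mul_pow_sub_one {g : ℂ → ℂ} (hg : Differentiable ℂ g)
    (hnc : ¬∃ c, ∀ z, g z = c) {k : ℕ}
    (hshare : ∀ z, g z ^ (k + 2) = 1 → ((k + 2 : ℕ) : ℂ) * g z ^ (k + 1) * deriv g z = 1) :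
    (∃ C > 0, ∀ z, ‖deriv g z‖ ≤ C * (1 + ‖g z‖)) ∧
    ∃ c : ℂ, ∀ z, ((k + 2 : ℕ) : ℂ) * g z ^ k * deriv g z *
      (((k + 2 : ℕ) : ℂ) * deriv g z - g z) = c * (g z ^ (k + 2) - 1) := by
  set n : ℕ := k + 2 with hn
  have hn0 : (n : ℂ) ≠ 0 := Nat.cast_ne_zero.2 (by omega)
  set F : ℂ → ℂ := fun z => g z ^ n with hFdef
  have hF' : ∀ z, HasDerivAt F (n * g z ^ (k + 1) * deriv g z) z :=
    fun z => (hg z).hasDerivAt.pow n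
  have hF : Differentiable ℂ F := fun z => (hF' z).differentiableAt
  have hF1 : ∀ z, F z = 1 → deriv F z = 1 := fun z hz => (hF' z).deriv.trans (hshare z hz)
  obtain ⟨K, hK, hgK⟩ := exists_entire_mul_eq (A := fun z => n * deriv g z - g z)
    (B := fun z => F z - 1) ((hg.deriv.const_mul _).sub hg) (hF.sub_const 1) (fun z hz => by
      have h1 : F z = 1 := sub_eq_zero.1 hz
      have h2 := hshare z h1
      refine ⟨?_, ?_⟩
      · have h3 : g z ^ (k + 2) = 1 := h1
        linear_combination (-(n : ℂ) * deriv g z) * h3 + g z * h2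
      · rw [((hF' z).sub_const 1).deriv, h2]
        exact one_ne_zero)
  obtain ⟨C, hC0, hC⟩ := exists_norm_deriv_le_one_add_norm hg hnc
    (exists_bound_deriv_of_norm_le_two hg hK (n := n) (by omega) hgK)
  have hgrow : ∀ c z, ‖g z‖ ≤ (‖g c‖ + 1) * Real.exp (C * dist z c) := fun c z =>
    norm_le_exp_of_norm_deriv_le hg hC0 fun w _ => hC w
  refine ⟨⟨C, hC0, hC⟩, ?_⟩
  have hA : ∀ z, ‖n * deriv g z - g z‖ ≤ (n * C + 1) * (1 + ‖g z‖) := by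
    intro z
    refine (norm_sub_le _ _).trans ?_
    rw [norm_mul, Complex.norm_natCast]
    have : (n : ℝ) * ‖deriv g z‖ ≤ n * (C * (1 + ‖g z‖)) := by gcongr; exact hC z
    linarith
  set φ : ℂ → ℂ := fun z => n * g z ^ k * deriv g z * K z with hφdef
  have hφ : Differentiable ℂ φ := (((hg.pow k).const_mul _).mul hg.deriv).mul hK
  have hφF : ∀ z, φ z * (F z - 1) = n * g z ^ k * deriv g z * (n * deriv g z - g z) := by
    intro z
    have := hgK z
    rw [this]
    ring
  have hsmall : ∀ z, ‖F z - 1‖ ≤ 1 / 2 → 1 / 2 ≤ ‖g z‖ ∧ ‖g z‖ ≤ 2 := by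
    intro z hz
    have h1 := norm_le_norm_add_norm_sub (F z) 1
    have h2 := norm_le_norm_add_norm_sub' (F z) 1
    rw [norm_one] at h1 h2
    have h3 : ‖F z‖ = ‖g z‖ ^ n := norm_pow _ _
    rw [h3] at h1 h2
    constructor
    · by_contra! hcon
      have := pow_le_of_le_one (norm_nonneg (g z)) (by linarith) (n := n) (by omega)
      linarith
    · by_contra! hcon
      have := le_self_pow₀ (by linarith : 1 ≤ ‖g z‖) (n := n) (by omega)
      linarith
  set R : ℝ := 3 * Real.exp C with hR
  have hR0 : 0 < R := by positivity
  suffices h : ∃ L, ∀ z, ‖φ z‖ ≤ L by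
    obtain ⟨L, hL⟩ := h
    have hb : Bornology.IsBounded (range φ) :=
      isBounded_iff_forall_norm_le.2 ⟨L, by rintro _ ⟨z, rfl⟩; exact hL z⟩
    refine ⟨φ 0, fun z => ?_⟩
    rw [← hφ.apply_eq_apply_of_bounded hb z 0, ← hφF]
  refine exists_norm_le_of_deriv_eq_one hF hφ hF1 (N := 6 * (n * C + 1))
    (N' := n * 2 ^ (k + 1) * (C * 3)) (M := n * R ^ (k + 1) * (C * (1 + R)))
    (by positivity) (by positivity) ?_ ?_ ?_ ?_
  · intro δ hδ
    set P : ℝ := n * C * (n * C + 1) with hP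
    have hP0 : 0 ≤ P := by positivity
    refine ⟨P * 2 ^ k * 9 / δ + 8 * P, fun z hz => ?_⟩
    have h1 : ‖φ z‖ * ‖F z - 1‖ ≤ P * ‖g z‖ ^ k * (1 + ‖g z‖) ^ 2 := by
      rw [← norm_mul, hφF, norm_mul, norm_mul, norm_mul, Complex.norm_natCast, norm_pow]
      calc n * ‖g z‖ ^ k * ‖deriv g z‖ * ‖n * deriv g z - g z‖
          ≤ n * ‖g z‖ ^ k * (C * (1 + ‖g z‖)) * ((n * C + 1) * (1 + ‖g z‖)) := by
            gcongr
            exacts [hC z, hA z]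
        _ = _ := by rw [hP]; ring
    rcases le_or_gt ‖g z‖ 2 with h2 | h2
    · have h3 : P * ‖g z‖ ^ k * (1 + ‖g z‖) ^ 2 ≤ P * 2 ^ k * 9 := by
        calc P * ‖g z‖ ^ k * (1 + ‖g z‖) ^ 2 ≤ P * 2 ^ k * (1 + 2) ^ 2 := by gcongr
          _ = _ := by ring
      have h4 : ‖φ z‖ ≤ P * 2 ^ k * 9 / δ := by
        rw [le_div_iff₀ hδ]
        exact (mul_le_mul_of_nonneg_left hz (norm_nonneg _)).trans (h1.trans h3)
      linarith
    · have h3 : 2 ≤ ‖g z‖ ^ n := h2.le.trans (le_self_pow₀ (by linarith) (by omega))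
      have h4 : ‖g z‖ ^ n / 2 ≤ ‖F z - 1‖ := by
        have h5 := norm_le_norm_add_norm_sub' (F z) 1
        have h6 : ‖F z‖ = ‖g z‖ ^ n := norm_pow _ _
        rw [norm_one, h6] at h5
        linarith
      have h7 : P * ‖g z‖ ^ k * (1 + ‖g z‖) ^ 2 ≤ 8 * P * (‖g z‖ ^ n / 2) := by
        calc P * ‖g z‖ ^ k * (1 + ‖g z‖) ^ 2 ≤ P * ‖g z‖ ^ k * (2 * ‖g z‖) ^ 2 := by
              gcongr; linarith
          _ = _ := by rw [hn]; ring
      have h8 : ‖φ z‖ ≤ 8 * P := by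
        refine le_of_mul_le_mul_right ?_ (by linarith : 0 < ‖g z‖ ^ n / 2)
        exact (mul_le_mul_of_nonneg_left h4 (norm_nonneg _)).trans (h1.trans h7)
      have : 0 ≤ P * 2 ^ k * 9 / δ := by positivity
      linarith
  · intro z hz
    obtain ⟨h1, h2⟩ := hsmall z hz
    have h3 : φ z * (F z - 1) * g z = deriv F z * (n * deriv g z - g z) := by
      rw [hφF, (hF' z).deriv]
      ring
    have h4 : ‖φ z * (F z - 1)‖ * ‖g z‖ ≤ ‖deriv F z‖ * ((n * C + 1) * 3) := by
      rw [← norm_mul, h3, norm_mul]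
      refine mul_le_mul_of_nonneg_left ((hA z).trans ?_) (norm_nonneg _)
      gcongr
      linarith
    have h5 : ‖φ z * (F z - 1)‖ * (1 / 2) ≤ ‖φ z * (F z - 1)‖ * ‖g z‖ := by gcongr
    linarith
  · intro z hz
    obtain ⟨h1, h2⟩ := hsmall z hz
    rw [(hF' z).deriv, norm_mul, norm_mul, Complex.norm_natCast, norm_pow]
    gcongr
    refine (hC z).trans ?_
    gcongr
    linarith
  · intro ζ w hζ hw
    have h1 : ‖g ζ‖ ≤ 2 := (hsmall ζ (by rw [hζ, sub_self, norm_zero]; norm_num)).2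
    have h2 : ‖g w‖ ≤ R := by
      refine (hgrow ζ w).trans ?_
      rw [hR]
      gcongr
      · linarith
      · nlinarith
    rw [(hF' w).deriv, norm_mul, norm_mul, Complex.norm_natCast, norm_pow]
    gcongr
    refine (hC w).trans ?_
    gcongr

theorem eq_zero_or_eq_zero_of_entire_mul_eq_zero {A B : ℂ → ℂ} (hA : Differentiable ℂ A)
    (hB : Differentiable ℂ B) (h : ∀ z, A z * B z = 0) : (∀ z, A z = 0) ∨ ∀ z, B z = 0 := by
  by_contra! hcon
  obtain ⟨⟨x, hx⟩, y, hy⟩ := hcon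
  have hBz : B =ᶠ[𝓝 x] 0 := by
    filter_upwards [hA.continuous.continuousAt.eventually_ne hx] with z hz
    exact (mul_eq_zero.1 (h z)).resolve_left hz
  have hBan : AnalyticOnNhd ℂ B univ := hB.differentiableOn.analyticOnNhd isOpen_univ
  have := hBan.eq_of_eventuallyEq (fun z _ => analyticAt_const) hBz
  exact hy (congrFun this y)

theorem exists_deriv_eq_mul_of_norm_deriv_le {g A : ℂ → ℂ} (hg : Differentiable ℂ g)
    (hA : Differentiable ℂ A) (h0 : ∀ z, A z ≠ 0) {C D : ℝ} (hC0 : 0 < C)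
    (hC : ∀ z, ‖deriv g z‖ ≤ C * (1 + ‖g z‖)) (hD0 : 0 < D)
    (hD : ∀ z, ‖A z‖ ≤ D * (1 + ‖g z‖)) :
    ∃ a, (∀ z, deriv A z = a * A z) ∧ (a ≠ 0 → ∀ w, w ≠ 0 → ∃ z, A z = w) := by
  obtain ⟨a, b, hab⟩ := exists_eq_exp_linear hA h0 (B := D * (‖g 0‖ + 2)) (C := C)
    (by positivity) hC0 (fun z => by
      have h1 := norm_le_exp_of_norm_deriv_le hg hC0 (c := 0) (z := z) fun w _ => hC w
      rw [dist_zero_right] at h1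
      have h2 : 1 ≤ Real.exp (C * ‖z‖) := Real.one_le_exp (by positivity)
      calc ‖A z‖ ≤ D * (1 + ‖g z‖) := hD z
        _ ≤ D * ((‖g 0‖ + 2) * Real.exp (C * ‖z‖)) := by gcongr; linarith
        _ = _ := by ring)
  refine ⟨a, fun z => ?_, fun ha w hw => ⟨(Complex.log w - b) / a, ?_⟩⟩
  · have h1 : HasDerivAt A (Complex.exp (a * z + b) * (a * 1)) z := by
      rw [show A = fun z => Complex.exp (a * z + b) from funext hab]
      exact (((hasDerivAt_id z).const_mul a).add_const b).cexp
    rw [h1.deriv, hab z]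
    ring
  · rw [hab, mul_div_cancel₀ _ ha, sub_add_cancel, Complex.exp_log hw]

theorem exists_eq_of_deriv_eq_mul {h : ℂ → ℂ} (hh : Differentiable ℂ h) {a : ℂ} (ha : a ≠ 0)
    (hd : ∀ z, deriv h z = a * h z) (hne : ∃ z, h z ≠ 0) {w : ℂ} (hw : w ≠ 0) : ∃ z, h z = w := by
  have hder : ∀ z, HasDerivAt (fun z => h z * Complex.exp (-(a * z))) 0 z := fun z => by
    have h1 := (hh z).hasDerivAt.mul ((((hasDerivAt_id z).const_mul a).neg).cexp)
    convert! h1 using 1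
    rw [hd]
    simp only [id]
    ring
  have hconst : ∀ z, h z = h 0 * Complex.exp (a * z) := fun z => by
    have h1 := is_const_of_deriv_eq_zero (fun z => (hder z).differentiableAt)
      (fun z => (hder z).deriv) z 0
    simp only [mul_zero, neg_zero, Complex.exp_zero, mul_one] at h1
    rw [← h1, mul_assoc, ← Complex.exp_add, neg_add_cancel, Complex.exp_zero, mul_one]
  have h0 : h 0 ≠ 0 := by
    rintro h0
    obtain ⟨z, hz⟩ := hne
    rw [hconst, h0, zero_mul] at hz
    exact hz rfl
  refine ⟨Complex.log (w / h 0) / a, ?_⟩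
  rw [hconst, mul_div_cancel₀ _ ha, Complex.exp_log (div_ne_zero hw h0), mul_div_cancel₀ _ h0]

theorem eq_zero_of_two_mul_deriv_mul_eq {g : ℂ → ℂ} (hg : Differentiable ℂ g)
    (hnc : ¬∃ c, ∀ z, g z = c) {C : ℝ} (hC0 : 0 < C)
    (hC : ∀ z, ‖deriv g z‖ ≤ C * (1 + ‖g z‖)) {c : ℂ}
    (hc : ∀ z, 2 * deriv g z * (2 * deriv g z - g z) = c * (g z ^ 2 - 1))
    (hshare : ∀ z, 2 * g z * deriv g z = 1 → g z ^ 2 = 1) : c = 0 := by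
  by_contra hc0
  obtain ⟨s, hs⟩ := IsAlgClosed.exists_pow_nat_eq (1 / 4 + c : ℂ) two_pos
  set α : ℂ := 1 / 4 + s / 2 with hα
  set β : ℂ := 1 / 4 - s / 2 with hβ
  set k : ℂ := -c / 4 with hk
  have hk0 : k ≠ 0 := div_ne_zero (neg_ne_zero.2 hc0) (by norm_num)
  set A : ℂ → ℂ := fun z => deriv g z - α * g z with hA
  have hAder : ∀ z, HasDerivAt A (deriv (deriv g) z - α * deriv g z) z := fun z =>
    (hg.deriv z).hasDerivAt.sub ((hg z).hasDerivAt.const_mul α)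
  have hAd : Differentiable ℂ A := fun z => (hAder z).differentiableAt
  have hAB : ∀ z, A z * (deriv g z - β * g z) = k := by
    intro z
    simp only [hA, hα, hβ, hk]
    linear_combination hc z / 4 - g z ^ 2 / 4 * hs
  have hA0 : ∀ z, A z ≠ 0 := fun z h => hk0 (by rw [← hAB z, h, zero_mul])
  obtain ⟨a, ha, hsurj⟩ := exists_deriv_eq_mul_of_norm_deriv_le hg hAd hA0 hC0 hC
    (D := C + ‖α‖) (by positivity) (fun z => by
      have h1 : ‖A z‖ ≤ ‖deriv g z‖ + ‖α‖ * ‖g z‖ := by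
        rw [← norm_mul]; exact norm_sub_le _ _
      nlinarith [hC z, norm_nonneg α, norm_nonneg (g z)])
  have hkey : ∀ z, a * k + a * A z ^ 2 - β * A z ^ 2 + α * k = 0 := by
    intro z
    have h1 : HasDerivAt (fun z => A z * (deriv g z - β * g z)) _ z :=
      (hAder z).mul ((hg.deriv z).hasDerivAt.sub ((hg z).hasDerivAt.const_mul β))
    rw [show (fun z => A z * (deriv g z - β * g z)) = fun _ => k from funext hAB] at h1
    have h2 := h1.unique (hasDerivAt_const z k)
    have h3 := (hAder z).deriv.symm.trans (ha z)
    have h4 := hAB z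
    have h5 : A z = deriv g z - α * g z := rfl
    have h6 : deriv (deriv g) z - β * deriv g z
        = a * A z - (β * A z - α * (deriv g z - β * g z)) := by
      rw [h5] at h3 ⊢
      linear_combination h3
    rw [h3, h6] at h2
    linear_combination h2 - (a + α) * h4
  have ha0 : a = 0 := by
    by_contra ha0
    obtain ⟨w, hw⟩ := IsAlgClosed.exists_pow_nat_eq (-k) two_pos
    have hw0 : w ≠ 0 := by
      rintro rfl
      exact hk0 (by simpa using hw.symm)
    obtain ⟨z, rfl⟩ := hsurj ha0 w hw0
    have h1 := hkey z
    rw [hw] at h1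
    apply hk0
    simp only [hα, hβ] at h1
    linear_combination 2 * h1
  have hAc : ∀ z, A z = A 0 := fun z =>
    is_const_of_deriv_eq_zero hAd (fun z => by rw [ha, ha0, zero_mul]) z 0
  set σ := A 0 with hσ
  have hσ0 : σ ≠ 0 := hA0 0
  have hg' : ∀ z, deriv g z = α * g z + σ := fun z => by
    rw [← hAc z]; simp [hA]
  have hs0 : s = 0 := by
    by_contra hs0
    refine hnc ⟨(k / σ - σ) / s, fun z => ?_⟩
    have h1 := hAB z
    rw [hAc z, hg' z] at h1
    field_simp
    simp only [hα, hβ] at h1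
    linear_combination h1
  have hσ2 : σ ^ 2 = 1 / 16 := by
    have h1 := hAB 0
    have h2 : σ = deriv g 0 - α * g 0 := rfl
    have h3 : β = α := by simp [hα, hβ, hs0]
    rw [h3, ← h2, hk] at h1
    rw [hs0] at hs
    linear_combination h1 + hs / 4
  have hα4 : α = 1 / 4 := by simp [hα, hs0]
  obtain ⟨z, hz⟩ := exists_eq_of_deriv_eq_mul (h := fun z => g z + 4 * σ) (hg.add_const _)
    (a := 1 / 4) (by norm_num) (fun z => by
      rw [deriv_add_const, hg', hα4]; ring)
    (by
      by_contra! hcon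
      exact hnc ⟨-(4 * σ), fun z => eq_neg_of_add_eq_zero_left (hcon z)⟩)
    (w := -(4 * σ)) (neg_ne_zero.2 (mul_ne_zero (by norm_num) hσ0))
  have hgz : g z = -(8 * σ) := by linear_combination hz
  have h1 := hshare z (by rw [hg', hgz, hα4]; linear_combination 16 * hσ2)
  rw [hgz] at h1
  have h2 : (4 : ℂ) = 1 := by linear_combination h1 - 64 * hσ2
  norm_num at h2

theorem eq_natCast_mul_deriv_of_share {g : ℂ → ℂ} (hg : Differentiable ℂ g)
    (hnc : ¬∃ c, ∀ z, g z = c) {n : ℕ} (hn : 2 ≤ n)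
    (hshare : ∀ z, g z ^ n = 1 ↔ (n : ℂ) * g z ^ (n - 1) * deriv g z = 1) :
    ∀ z, g z = n * deriv g z := by
  obtain ⟨k, rfl⟩ := Nat.exists_eq_add_of_le' hn
  obtain ⟨⟨C, hC0, hC⟩, c, hc⟩ := exists_eq_const_mul_pow_sub_one hg hnc fun z => (hshare z).1
  by_cases hc0 : c = 0
  · have hprod : ∀ z, g z ^ k * (deriv g z * (((k + 2 : ℕ) : ℂ) * deriv g z - g z)) = 0 := by
      intro z
      have h1 := hc z
      rw [hc0, zero_mul] at h1
      have h2 : ((k + 2 : ℕ) : ℂ) ≠ 0 := Nat.cast_ne_zero.2 (by omega)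
      refine (mul_eq_zero.1 ?_).resolve_left h2
      linear_combination h1
    have hY : Differentiable ℂ fun z => ((k + 2 : ℕ) : ℂ) * deriv g z - g z :=
      (hg.deriv.const_mul _).sub hg
    rcases eq_zero_or_eq_zero_of_entire_mul_eq_zero (hg.pow k) (hg.deriv.mul hY) hprod with h | h
    · exact absurd ⟨0, fun z => eq_zero_of_pow_eq_zero (h z)⟩ hnc
    rcases eq_zero_or_eq_zero_of_entire_mul_eq_zero hg.deriv hY h with h | h
    · exact absurd ⟨g 0, fun z => is_const_of_deriv_eq_zero hg h z 0⟩ hnc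
    · exact fun z => (sub_eq_zero.1 (h z)).symm
  obtain rfl | hk := Nat.eq_zero_or_pos k
  · refine absurd (eq_zero_of_two_mul_deriv_mul_eq hg hnc hC0 hC (c := c) (fun z => ?_)
      fun z hz => ?_) hc0
    · simpa using hc z
    · simpa using (hshare z).2 (by simpa using hz)
  have hg0 : ∀ z, g z ≠ 0 := fun z h => hc0 (by simpa [h, hk.ne'] using (hc z).symm)
  obtain ⟨a, ha, hsurj⟩ := exists_deriv_eq_mul_of_norm_deriv_le hg hg hg0 hC0 hC (D := 1)
    one_pos (fun z => by linarith)
  have ha0 : a ≠ 0 := by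
    rintro rfl
    exact hnc ⟨g 0, fun z => is_const_of_deriv_eq_zero hg (fun w => by rw [ha, zero_mul]) z 0⟩
  obtain ⟨z₁, hz₁⟩ := hsurj ha0 1 one_ne_zero
  have hna := (hshare z₁).1 (by rw [hz₁, one_pow])
  rw [ha, hz₁, one_pow, mul_one, mul_one] at hna
  intro z
  rw [ha]
  linear_combination (-g z) * hna

theorem hasDerivAt_comp_line {E : Type*} [NormedAddCommGroup E] [NormedSpace ℂ E] {f : E → ℂ}
    (hf : Differentiable ℂ f) (z u : E) (t : ℂ) :
    HasDerivAt (fun t : ℂ => f (z + t • u)) (fderiv ℂ f (z + t • u) u) t := by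
  have h1 : HasDerivAt (fun t : ℂ => z + t • u) u t := by
    simpa using ((hasDerivAt_id t).smul_const u).const_add z
  exact (hf (z + t • u)).hasFDerivAt.comp_hasDerivAt t h1

theorem eq_zero_or_eq_zero_of_differentiable_mul_eq_zero {E : Type*} [NormedAddCommGroup E]
    [NormedSpace ℂ E] {P Q : E → ℂ} (hP : Differentiable ℂ P) (hQ : Differentiable ℂ Q)
    (h : ∀ z, P z * Q z = 0) : (∀ z, P z = 0) ∨ ∀ z, Q z = 0 := by
  by_contra! hcon
  obtain ⟨⟨x, hx⟩, y, hy⟩ := hcon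
  rcases eq_zero_or_eq_zero_of_entire_mul_eq_zero
    (fun t => (hasDerivAt_comp_line hP x (y - x) t).differentiableAt)
    (fun t => (hasDerivAt_comp_line hQ x (y - x) t).differentiableAt)
    (fun t => h (x + t • (y - x))) with h0 | h0
  · exact hx (by simpa using h0 0)
  · exact hy (by simpa using h0 1)

theorem line_eq_const_or_eq_exp_mul {E : Type*} [NormedAddCommGroup E] [NormedSpace ℂ E]
    {f : E → ℂ} (hf : Differentiable ℂ f) {u : E} {n : ℕ} (hn : 2 ≤ n)
    (hshare : ∀ z, f z ^ n = 1 ↔ (n : ℂ) * f z ^ (n - 1) * fderiv ℂ f z u = 1) (z : E) (t : ℂ) :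
    f (z + t • u) = f z ∨ f (z + t • u) = Complex.exp (t / n) * f z := by
  have hn0 : (n : ℂ) ≠ 0 := Nat.cast_ne_zero.2 (by omega)
  have hg := hasDerivAt_comp_line hf z u
  have hgd : Differentiable ℂ fun t : ℂ => f (z + t • u) := fun t => (hg t).differentiableAt
  by_cases hnc : ∃ c, ∀ t : ℂ, f (z + t • u) = c
  · obtain ⟨c, hc⟩ := hnc
    left
    have h0 := hc 0
    rw [zero_smul, add_zero] at h0
    rw [hc, h0]
  · right
    have hode := eq_natCast_mul_deriv_of_share hgd hnc hn fun t => by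
      rw [(hg t).deriv]
      exact hshare _
    have hder : ∀ t, HasDerivAt (fun t : ℂ => f (z + t • u) * Complex.exp (-(t / n))) 0 t := by
      intro t
      convert! (hgd t).hasDerivAt.mul (((hasDerivAt_id t).div_const (n : ℂ)).neg.cexp) using 1
      rw [hode t]
      simp only [id]
      field_simp
      ring
    have h1 := is_const_of_deriv_eq_zero (fun t => (hder t).differentiableAt)
      (fun t => (hder t).deriv) t 0
    simp only [zero_smul, add_zero, zero_div, neg_zero, Complex.exp_zero, mul_one] at h1
    rw [← h1, mul_left_comm, ← Complex.exp_add, add_neg_cancel, Complex.exp_zero, mul_one]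

theorem eq_natCast_mul_fderiv_of_share {E : Type*} [NormedAddCommGroup E] [NormedSpace ℂ E]
    {f : E → ℂ} (hf : Differentiable ℂ f) {u : E} {n : ℕ} (hn : 2 ≤ n)
    (hne : ∃ z, fderiv ℂ f z u ≠ 0)
    (hshare : ∀ z, f z ^ n = 1 ↔ (n : ℂ) * f z ^ (n - 1) * fderiv ℂ f z u = 1) (z : E) :
    f z = n * fderiv ℂ f z u := by
  have hn0 : (n : ℂ) ≠ 0 := Nat.cast_ne_zero.2 (by omega)
  obtain ⟨z₁, hz₁⟩ := hne
  have hev : ∀ᶠ t : ℂ in 𝓝[≠] 0, f (z + t • u) = Complex.exp (t / n) * f z := by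
    have h1 := hasDerivAt_comp_line hf z₁ u 0
    rw [zero_smul, add_zero] at h1
    filter_upwards [h1.eventually_ne (c := f z₁) hz₁] with t ht
    have hshift : Differentiable ℂ fun w => f (w + t • u) := fun w =>
      (hf (w + t • u)).comp w (differentiableAt_id.add_const _)
    rcases eq_zero_or_eq_zero_of_differentiable_mul_eq_zero (hshift.sub hf)
      (hshift.sub (hf.const_mul (Complex.exp (t / n)))) (fun w => by
        rcases line_eq_const_or_eq_exp_mul hf hn hshare w t with h | h <;> simp [h]) with h | h
    · exact absurd (sub_eq_zero.1 (h z₁)) ht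
    · exact sub_eq_zero.1 (h z)
  have hev' : (fun t : ℂ => f (z + t • u)) =ᶠ[𝓝 0] fun t => Complex.exp (t / n) * f z := by
    rw [eventually_nhdsWithin_iff] at hev
    filter_upwards [hev] with t ht
    by_cases h0 : t = 0
    · simp [h0]
    · exact ht h0
  have h1 := hasDerivAt_comp_line hf z u 0
  have h2 : HasDerivAt (fun t : ℂ => Complex.exp (t / n) * f z) _ 0 :=
    (((hasDerivAt_id (0 : ℂ)).div_const (n : ℂ)).cexp).mul_const (f z)
  have h3 := h1.unique (h2.congr_of_eventuallyEq hev')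
  simp only [zero_smul, add_zero, id, zero_div, Complex.exp_zero, one_mul] at h3
  rw [h3]
  field_simp

end EntireSharing

/-- Paper's Theorem 2.3. -/
theorem power_share_one_IM_first_derivative
    (m : ℕ) (hm : 1 ≤ m) (f : (Fin m → ℂ) → ℂ)
    (hf : Differentiable ℂ f) (hnc : ¬∃ c : ℂ, ∀ z, f z = c)
    (u : Fin m → ℂ) (hu : ∑ j, Complex.normSq (u j) = 1)
    (n : ℕ) (hn : 2 ≤ n)
    (hne : ¬∀ z, dirDeriv u (fun w => f w ^ n) z = 0)
    (hshare : ∀ z, f z ^ n = 1 ↔ dirDeriv u (fun w => f w ^ n) z = 1) :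
    ∀ z, f z = (n : ℂ) * dirDeriv u f z := by
  have hpow : ∀ z, dirDeriv u (fun w => f w ^ n) z = n * f z ^ (n - 1) * fderiv ℂ f z u := by
    intro z
    simp [dirDeriv, fderiv_fun_pow n (hf z), mul_assoc]
  refine eq_natCast_mul_fderiv_of_share hf hn ?_ fun z => by rw [← hpow]; exact hshare z
  by_contra! hcon
  exact hne fun z => by rw [hpow, hcon, mul_zero]
end

section
/- Let m ≥ 1, let f : ℂ^m → ℂ be an entire function, let u ∈ ℂ^m be a unit vector, and let k, n be positive integers with n ≥ k. Then there exists an entire function R : ℂ^m → ℂ such that ∂_u^k(f^n) = (n!/(n−k)!)·f^{n−k}·(∂_u f)^k + f^{n−k+1}·R. (The leading-term expansion (2.2) of ∂_u^k(f^n) used throughout the paper: every term other than the leading one is divisible by f^{n−k+1}.) -/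
/-- Cauchy's formula for the directional derivative, over a unit circle in direction `u`. -/
theorem dirDeriv_eq_circleIntegral {m : ℕ} (u : Fin m → ℂ) {f : (Fin m → ℂ) → ℂ}
    (hf : Differentiable ℂ f) (z : Fin m → ℂ) :
    dirDeriv u f z =
      (2 * Real.pi * Complex.I : ℂ)⁻¹ * ∮ t in C(0, 1), (t ^ 2)⁻¹ * f (z + t • u) := by
  have hline : HasDerivAt (fun t : ℂ => z + t • u) u 0 := by
    simpa using ((hasDerivAt_id (0 : ℂ)).smul_const u).const_add z
  have hderiv : HasDerivAt (fun t : ℂ => f (z + t • u)) (dirDeriv u f z) 0 := by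
    have h := (hf (z + (0 : ℂ) • u)).hasFDerivAt.comp_hasDerivAt (0 : ℂ) hline
    simpa [dirDeriv, Function.comp_def] using h
  have hdiff : Differentiable ℂ fun t : ℂ => f (z + t • u) := by fun_prop
  have h := hdiff.differentiableOn.deriv_eq_smul_circleIntegral (c := 0) one_pos
  simp only [sub_zero, one_div, smul_eq_mul, hderiv.deriv] at h
  rw [h, inv_mul_cancel_left₀ Complex.two_pi_I_ne_zero]

/-- The directional derivative of an entire function is entire. -/
theorem differentiable_dirDeriv {m : ℕ} (u : Fin m → ℂ) {f : (Fin m → ℂ) → ℂ}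
    (hf : Differentiable ℂ f) : Differentiable ℂ (dirDeriv u f) := by
  intro z₀
  have hcont := hf.continuous
  obtain ⟨C, hC⟩ := (isCompact_closedBall z₀ (2 + ‖u‖)).exists_bound_of_continuousOn
    hcont.continuousOn
  have hfderiv : ∀ z ∈ Metric.closedBall z₀ (1 + ‖u‖), ‖fderiv ℂ f z‖ ≤ (C + C) / 1 := by
    intro z hz
    rw [Metric.mem_closedBall] at hz
    refine Complex.norm_fderiv_le_div_of_mapsTo_ball hf.differentiableOn (fun w hw => ?_) one_pos
    rw [Metric.mem_ball] at hw
    rw [Metric.mem_closedBall, dist_eq_norm]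
    have hw' : dist w z₀ ≤ 2 + ‖u‖ := by linarith [dist_triangle w z z₀]
    have hfw := hC w hw'
    have hfz := hC z (Metric.mem_closedBall.2 (by linarith))
    linarith [norm_sub_le (f w) (f z)]
  let a : ℝ → ℂ := fun θ => deriv (circleMap 0 1) θ * (circleMap 0 1 θ ^ 2)⁻¹
  have ha : Continuous a := by
    simp only [a, deriv_circleMap]
    exact ((continuous_circleMap 0 1).mul continuous_const).mul
      (((continuous_circleMap 0 1).pow 2).inv₀ fun θ =>
        pow_ne_zero 2 (circleMap_ne_center one_ne_zero))
  have ha_norm : ∀ θ, ‖a θ‖ = 1 := fun θ => by simp [a]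
  let F : (Fin m → ℂ) → ℝ → ℂ := fun z θ => a θ * f (z + circleMap 0 1 θ • u)
  let F' : (Fin m → ℂ) → ℝ → (Fin m → ℂ) →L[ℂ] ℂ :=
    fun z θ => a θ • fderiv ℂ f (z + circleMap 0 1 θ • u)
  have hF_cont : ∀ z, Continuous (F z) := fun z => by fun_prop
  have hF'_meas : Measurable (F' z₀) :=
    ha.measurable.smul ((measurable_fderiv ℂ f).comp
      (by fun_prop : Continuous fun θ => z₀ + circleMap 0 1 θ • u).measurable)
  have key := intervalIntegral.hasFDerivAt_integral_of_dominated_of_fderiv_le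
    (μ := MeasureTheory.volume) (a := 0) (b := 2 * Real.pi) (F := F) (F' := F')
    (bound := fun _ => (C + C) / 1) (Metric.ball_mem_nhds z₀ one_pos)
    (.of_forall fun z => (hF_cont z).aestronglyMeasurable)
    ((hF_cont z₀).intervalIntegrable _ _) hF'_meas.aestronglyMeasurable
    (.of_forall fun θ _ z hz => by
      rw [norm_smul, ha_norm, one_mul]
      refine hfderiv _ ?_
      rw [Metric.mem_ball, dist_eq_norm] at hz
      rw [Metric.mem_closedBall, dist_eq_norm, add_sub_right_comm]
      refine (norm_add_le _ _).trans (add_le_add hz.le ?_)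
      simp [norm_smul])
    intervalIntegrable_const
    (.of_forall fun θ _ z _ => by
      have h := (hf (z + circleMap 0 1 θ • u)).hasFDerivAt.comp z
        ((hasFDerivAt_id z).add_const (circleMap 0 1 θ • u))
      simpa [F, F', Function.comp_def] using h.const_mul (a θ))
  refine (key.differentiableAt.const_mul (2 * Real.pi * Complex.I : ℂ)⁻¹).congr_of_eventuallyEq
    (.of_forall fun z => ?_)
  simp only [dirDeriv_eq_circleIntegral u hf z, circleIntegral, F, a, smul_eq_mul, mul_assoc]

/-- The leading-term expansion (2.2) of `∂_u^k (f^n)`: every term other than the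
leading one `(n!/(n-k)!) f^(n-k) (∂_u f)^k` is divisible by `f^(n-k+1)`. Here
`n.descFactorial k = n!/(n-k)!`. -/
theorem leading_term_expansion
    (m : ℕ) (hm : 1 ≤ m) (f : (Fin m → ℂ) → ℂ) (hf : Differentiable ℂ f)
    (u : Fin m → ℂ) (hu : ∑ j, Complex.normSq (u j) = 1)
    (k n : ℕ) (hk : 1 ≤ k) (hn : k ≤ n) :
    ∃ R : (Fin m → ℂ) → ℂ, Differentiable ℂ R ∧
      ∀ z, (dirDeriv u)^[k] (fun w => f w ^ n) z =
        (n.descFactorial k : ℂ) * f z ^ (n - k) * (dirDeriv u f z) ^ k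
          + f z ^ (n - k + 1) * R z := by
  clear hk
  induction k with
  | zero => exact ⟨0, differentiable_const 0, by simp⟩
  | succ k ih =>
    obtain ⟨R, hR, hexp⟩ := ih (by omega)
    have hg := differentiable_dirDeriv u hf
    have hg' := differentiable_dirDeriv u hg
    have hR' := differentiable_dirDeriv u hR
    refine ⟨fun z => (n.descFactorial k : ℂ) * (k * dirDeriv u f z ^ (k - 1) *
      dirDeriv u (dirDeriv u f) z) + (n - k + 1 : ℕ) * dirDeriv u f z * R z +
      f z * dirDeriv u R z, by fun_prop, fun z => ?_⟩
    obtain ⟨d, rfl⟩ := Nat.exists_eq_add_of_le hn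
    have hd : k + 1 + d - k = d + 1 := by omega
    have hd' : k + 1 + d - (k + 1) = d := by omega
    rw [Function.iterate_succ_apply', funext hexp, Nat.descFactorial_succ]
    simp only [hd, hd']
    have h := ((((hf z).hasFDerivAt.pow (d + 1)).const_mul
      ((k + 1 + d).descFactorial k : ℂ)).mul ((hg z).hasFDerivAt.pow k)).add
      (((hf z).hasFDerivAt.pow (d + 1 + 1)).mul (hR z).hasFDerivAt)
    have h' := congrArg (fun L => L u) h.fderiv
    refine h'.trans ?_
    simp only [dirDeriv, add_apply, smul_apply,
      smul_eq_mul, nsmul_eq_mul, add_tsub_cancel_right]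
    push_cast
    ring
end
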